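/- arXiv:1612.03714 — 3 statements merged into one kernel-verified Lean document; each statement's English description precedes it below -/
import Mathlib

section
/- Let E be a real Banach space, T > 0, let B : [0,T] → L(E,E) be continuous, and let κ : [0,T] → ℝ be continuous and nonnegative with ‖B(s)‖ ≤ κ(s) for all s ∈ [0,T]. Let Q : [0,T] → L(E,E) solve the resolvent equation started at 0, i.e. Q(0) = Id and Q′(t) = −Q(t)∘B(t) for all t ∈ [0,T]. Fix times 0 < t₁ < t₂ < ⋯ < t_N ≤ T and vectors a₁,…,a_N ∈ E, set v(s) := Σ_{i : t_i > s} a_i, and let μ_κ be the measure on [0,T] with Lebesgue density s ↦ κ(s)·exp(∫_0^s κ(u) du). Then for every real q ≥ 1: ‖Σ_{i=1}^N Q(t_i) a_i‖^q ≤ (1 + μ_κ([0,T]))^{q−1} · ( ‖v(0)‖^q + ∫_0^T ‖v(s)‖^q μ_κ(ds) ). -/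
open MeasureTheory

theorem aux_norm_Q_le
    {E : Type*} [NormedAddCommGroup E] [NormedSpace ℝ E]
    (T : ℝ) (B : ℝ → E →L[ℝ] E)
    (κ : ℝ → ℝ) (hκ : Continuous κ)
    (hBκ : ∀ s ∈ Set.Icc (0:ℝ) T, ‖B s‖ ≤ κ s)
    (Q : ℝ → E →L[ℝ] E) (hQ0 : Q 0 = 1)
    (hQ : ∀ t ∈ Set.Icc (0:ℝ) T,
      HasDerivWithinAt Q (-((Q t).comp (B t))) (Set.Icc 0 T) t) :
    ∀ s ∈ Set.Icc (0:ℝ) T, ‖Q s‖ ≤ Real.exp (∫ u in (0:ℝ)..s, κ u) := by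
  have key : ∀ ε : ℝ, 0 < ε → ∀ s ∈ Set.Icc (0:ℝ) T,
      ‖Q s‖ ≤ Real.exp ((∫ u in (0:ℝ)..s, κ u) + ε * s) := by
    intro ε hε
    have hd : ∀ x, HasDerivAt (fun s => Real.exp ((∫ u in (0:ℝ)..s, κ u) + ε * s))
        (Real.exp ((∫ u in (0:ℝ)..x, κ u) + ε * x) * (κ x + ε)) x := by
      intro x
      have h1 : HasDerivAt (fun s => ∫ u in (0:ℝ)..s, κ u) (κ x) x :=
        intervalIntegral.integral_hasDerivAt_right (hκ.intervalIntegrable _ _)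
          hκ.stronglyMeasurable.stronglyMeasurableAtFilter hκ.continuousAt
      have h2 : HasDerivAt (fun s => ε * s) ε x := by
        simpa using (hasDerivAt_id x).const_mul ε
      exact (h1.add h2).exp
    intro s hs
    refine image_norm_le_of_norm_deriv_right_lt_deriv_boundary (a := 0) (b := T) (f := Q)
      (f' := fun t => -((Q t).comp (B t)))
      (fun x hx => (hQ x hx).continuousWithinAt) ?_ ?_ hd ?_ hs
    · intro x hx
      exact (hQ x ⟨hx.1, hx.2.le⟩).mono_of_mem_nhdsWithin (Icc_mem_nhdsGE_of_mem hx)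
    · simp only [hQ0, intervalIntegral.integral_same, mul_zero, add_zero, Real.exp_zero]
      exact ContinuousLinearMap.norm_id_le
    · intro x hx hx2
      have hx' : x ∈ Set.Icc (0:ℝ) T := ⟨hx.1, hx.2.le⟩
      rw [norm_neg]
      have hpos := Real.exp_pos ((∫ u in (0:ℝ)..x, κ u) + ε * x)
      calc ‖(Q x).comp (B x)‖ ≤ ‖Q x‖ * ‖B x‖ := ContinuousLinearMap.opNorm_comp_le _ _
        _ ≤ ‖Q x‖ * κ x := by gcongr; exact hBκ x hx'
        _ < _ := by rw [hx2]; nlinarith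
  intro s hs
  have hc : Filter.Tendsto (fun ε : ℝ => Real.exp ((∫ u in (0:ℝ)..s, κ u) + ε * s))
      (nhdsWithin 0 (Set.Ioi 0)) (nhds (Real.exp ((∫ u in (0:ℝ)..s, κ u) + 0 * s))) := by
    apply Filter.Tendsto.mono_left _ nhdsWithin_le_nhds
    exact Continuous.tendsto (by fun_prop) 0
  rw [zero_mul, add_zero] at hc
  refine ge_of_tendsto hc ?_
  filter_upwards [self_mem_nhdsWithin] with ε hε using key ε hε s hs

theorem aux_sum_eq
    {E : Type*} [NormedAddCommGroup E] [NormedSpace ℝ E] [CompleteSpace E]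
    (T : ℝ)
    (B : ℝ → E →L[ℝ] E) (hB : ContinuousOn B (Set.Icc 0 T))
    (Q : ℝ → E →L[ℝ] E) (hQ0 : Q 0 = 1)
    (hQ : ∀ t ∈ Set.Icc (0:ℝ) T,
      HasDerivWithinAt Q (-((Q t).comp (B t))) (Set.Icc 0 T) t)
    (N : ℕ) (t : Fin N → ℝ)
    (ht0 : ∀ i, 0 < t i) (htT : ∀ i, t i ≤ T)
    (a : Fin N → E)
    (v : ℝ → E) (hv : ∀ s, v s = ∑ i, if s < t i then a i else 0) :
    ∑ i, Q (t i) (a i) = v 0 - ∫ s in Set.Icc 0 T, Q s (B s (v s)) := by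
  have hQc : ContinuousOn Q (Set.Icc 0 T) := fun x hx => (hQ x hx).continuousWithinAt
  have hg : ∀ i, ContinuousOn (fun s => Q s (B s (a i))) (Set.Icc 0 T) := fun i =>
    hQc.clm_apply (hB.clm_apply continuousOn_const)
  have hint : ∀ i, Integrable ((Set.Iio (t i)).indicator (fun s => Q s (B s (a i))))
      (volume.restrict (Set.Icc 0 T)) := fun i =>
    ((hg i).integrableOn_compact isCompact_Icc).indicator measurableSet_Iio
  have h1 : ∀ s, Q s (B s (v s)) =
      ∑ i, (Set.Iio (t i)).indicator (fun s => Q s (B s (a i))) s := by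
    intro s
    rw [hv, map_sum, map_sum]
    refine Finset.sum_congr rfl fun i _ => ?_
    by_cases h : s < t i <;> simp [h]
  have h2 : ∀ i, ∫ s in Set.Icc 0 T, (Set.Iio (t i)).indicator (fun s => Q s (B s (a i))) s
      = a i - Q (t i) (a i) := by
    intro i
    have hsub : Set.Icc 0 (t i) ⊆ Set.Icc 0 T := Set.Icc_subset_Icc_right (htT i)
    have hset : Set.Icc 0 T ∩ Set.Iio (t i) = Set.Ico 0 (t i) := by
      ext x
      simp only [Set.mem_inter_iff, Set.mem_Icc, Set.mem_Iio, Set.mem_Ico]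
      have := htT i
      constructor
      · rintro ⟨⟨h1, h2⟩, h3⟩; exact ⟨h1, h3⟩
      · rintro ⟨h1, h2⟩; exact ⟨⟨h1, by linarith⟩, h2⟩
    rw [setIntegral_indicator measurableSet_Iio, hset, integral_Ico_eq_integral_Ioo,
      ← integral_Ioc_eq_integral_Ioo, ← intervalIntegral.integral_of_le (ht0 i).le]
    have := intervalIntegral.integral_eq_sub_of_hasDerivAt_of_le (ht0 i).le
      (f := fun s => - Q s (a i)) (f' := fun s => Q s (B s (a i)))
      ((hQc.mono hsub).clm_apply continuousOn_const).neg ?_ ?_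
    · rw [this, hQ0]; simp; abel
    · intro x hx
      have hx' : x ∈ Set.Icc 0 T := hsub ⟨hx.1.le, hx.2.le⟩
      have h := (hQ x hx').hasDerivAt (Icc_mem_nhds hx.1 (hx.2.trans_le (htT i)))
      have h' := (h.clm_apply (hasDerivAt_const x (a i))).fun_neg
      simpa using h'
    · apply ContinuousOn.intervalIntegrable
      rw [Set.uIcc_of_le (ht0 i).le]
      exact (hg i).mono hsub
  simp_rw [h1]
  rw [integral_finsetSum _ (fun i _ => hint i), hv]
  simp_rw [h2]
  simp [ht0]

theorem aux_jensen (ν : Measure ℝ) [IsFiniteMeasure ν] (f : ℝ → ℝ) (hf : Measurable f)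
    (hf0 : ∀ s, 0 ≤ f s) (C : ℝ) (hC : ∀ s, f s ≤ C) (q : ℝ) (hq : 1 ≤ q) :
    (f 0 + ∫ s, f s ∂ν) ^ q ≤
      (1 + (ν Set.univ).toReal) ^ (q - 1) * (f 0 ^ q + ∫ s, f s ^ q ∂ν) := by
  have hi : ∀ ρ : Measure ℝ, IsFiniteMeasure ρ → Integrable f ρ := fun ρ _ =>
    Integrable.of_bound hf.aestronglyMeasurable C
      (Filter.Eventually.of_forall fun s => by
        rw [Real.norm_of_nonneg (hf0 s)]; exact hC s)
  have hiq : ∀ ρ : Measure ℝ, IsFiniteMeasure ρ → Integrable (fun s => f s ^ q) ρ := fun ρ _ =>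
    Integrable.of_bound (hf.pow_const q).aestronglyMeasurable (C ^ q)
      (Filter.Eventually.of_forall fun s => by
        rw [Real.norm_of_nonneg (Real.rpow_nonneg (hf0 s) _)]
        exact Real.rpow_le_rpow (hf0 s) (hC s) (by linarith))
  set ρ : Measure ℝ := Measure.dirac 0 + ν with hρ
  have hne : NeZero ρ := ⟨by
    intro h
    have : ρ Set.univ = 0 := by rw [h]; simp
    rw [hρ] at this
    simp at this⟩
  have hJ := (convexOn_rpow hq).map_average_le (μ := ρ) (f := f)
    (Real.continuous_rpow_const (by linarith)).continuousOn isClosed_Ici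
    (Filter.Eventually.of_forall fun s => hf0 s) (hi ρ inferInstance) (hiq ρ inferInstance)
  have hM : ρ.real Set.univ = 1 + (ν Set.univ).toReal := by
    rw [Measure.real, hρ, Measure.add_apply, ENNReal.toReal_add (by simp) (by simp)]
    simp
  rw [average_eq, average_eq, hM, hρ, integral_add_measure (hi _ inferInstance) (hi _ inferInstance),
    integral_add_measure (hiq _ inferInstance) (hiq _ inferInstance), integral_dirac,
    integral_dirac] at hJ
  set M := 1 + (ν Set.univ).toReal with hMd
  have hMpos : 0 < M := by positivity
  have hS : 0 ≤ f 0 + ∫ s, f s ∂ν := add_nonneg (hf0 0) (integral_nonneg hf0)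
  rw [smul_eq_mul, smul_eq_mul, Real.mul_rpow (by positivity) hS,
    Real.inv_rpow hMpos.le] at hJ
  have hMq : 0 < M ^ q := Real.rpow_pos_of_pos hMpos q
  rw [inv_mul_le_iff₀ hMq] at hJ
  rw [Real.rpow_sub_one hMpos.ne']
  calc _ ≤ _ := hJ
    _ = _ := by ring

/-- Deterministic core of Theorem 1.2 (1) ⇒ (3): if `Q` solves the resolvent equation on
`[0,T]` started at `0` with `‖B(s)‖ ≤ κ(s)`, `κ` continuous nonnegative, then for
`0 < t₁ < ⋯ < t_N ≤ T`, `v(s) = Σ_{i : t_i > s} a_i` and the measure `μ_κ` with density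
`s ↦ κ(s) e^{∫_0^s κ}` on `[0,T]`, one has for every `q ≥ 1`:
`‖Σ Q(t_i)a_i‖^q ≤ (1 + μ_κ([0,T]))^{q−1}(‖v(0)‖^q + ∫_0^T ‖v(s)‖^q μ_κ(ds))`. -/
theorem resolvent_sum_rpow_le
    {E : Type*} [NormedAddCommGroup E] [NormedSpace ℝ E] [CompleteSpace E]
    (T : ℝ) (hT : 0 < T)
    (B : ℝ → E →L[ℝ] E) (hB : ContinuousOn B (Set.Icc 0 T))
    (κ : ℝ → ℝ) (hκ : ContinuousOn κ (Set.Icc 0 T))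
    (hκ0 : ∀ s ∈ Set.Icc (0:ℝ) T, 0 ≤ κ s)
    (hBκ : ∀ s ∈ Set.Icc (0:ℝ) T, ‖B s‖ ≤ κ s)
    (Q : ℝ → E →L[ℝ] E) (hQ0 : Q 0 = 1)
    (hQ : ∀ t ∈ Set.Icc (0:ℝ) T,
      HasDerivWithinAt Q (-((Q t).comp (B t))) (Set.Icc 0 T) t)
    (N : ℕ) (hN : 0 < N) (t : Fin N → ℝ) (ht : StrictMono t)
    (ht0 : ∀ i, 0 < t i) (htT : ∀ i, t i ≤ T)
    (a : Fin N → E)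
    (v : ℝ → E) (hv : ∀ s, v s = ∑ i, if s < t i then a i else 0)
    (μ : Measure ℝ)
    (hμ : μ = (volume.restrict (Set.Icc 0 T)).withDensity
      (fun s => ENNReal.ofReal (κ s * Real.exp (∫ u in (0:ℝ)..s, κ u))))
    (q : ℝ) (hq : 1 ≤ q) :
    ‖∑ i, Q (t i) (a i)‖ ^ q ≤
      (1 + (μ (Set.Icc 0 T)).toReal) ^ (q - 1) *
        (‖v 0‖ ^ q + ∫ s, ‖v s‖ ^ q ∂μ) := by
  classical
  set κ' : ℝ → ℝ := Set.IccExtend hT.le ((Set.Icc 0 T).restrict κ) with hκ'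
  have hc : Continuous κ' := (continuousOn_iff_continuous_restrict.1 hκ).Icc_extend'
  have heq : ∀ s ∈ Set.Icc (0:ℝ) T, κ' s = κ s := fun s hs => by
    rw [hκ', Set.IccExtend_of_mem _ _ hs]; rfl
  have hn : ∀ s, 0 ≤ κ' s := fun s => hκ0 _ (Set.projIcc 0 T hT.le s).2
  have hKeq : ∀ s ∈ Set.Icc (0:ℝ) T, ∫ u in (0:ℝ)..s, κ' u = ∫ u in (0:ℝ)..s, κ u := by
    intro s hs
    apply intervalIntegral.integral_congr
    intro u hu
    rw [Set.uIcc_of_le hs.1] at hu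
    exact heq u ⟨hu.1, hu.2.trans hs.2⟩
  have hKc : Continuous fun s => ∫ u in (0:ℝ)..s, κ' u :=
    intervalIntegral.continuous_primitive (fun a b => hc.intervalIntegrable a b) 0
  set w : ℝ → ℝ := fun s => κ' s * Real.exp (∫ u in (0:ℝ)..s, κ' u) with hw
  have hwc : Continuous w := hc.mul (Real.continuous_exp.comp hKc)
  have hwn : ∀ s, 0 ≤ w s := fun s => mul_nonneg (hn s) (Real.exp_pos _).le
  have hμ' : μ = (volume.restrict (Set.Icc 0 T)).withDensity
      (fun s => ENNReal.ofReal (w s)) := by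
    rw [hμ]
    apply withDensity_congr_ae
    filter_upwards [ae_restrict_mem measurableSet_Icc] with s hs
    simp only [hw]
    rw [heq s hs, hKeq s hs]
  have hwi : Integrable w (volume.restrict (Set.Icc 0 T)) :=
    hwc.continuousOn.integrableOn_compact isCompact_Icc
  have hfin : IsFiniteMeasure μ := by
    rw [hμ']
    exact isFiniteMeasure_withDensity_ofReal hwi.2
  have hmass : μ (Set.Icc 0 T) = μ Set.univ := by
    rw [hμ', withDensity_apply _ measurableSet_Icc, withDensity_apply _ MeasurableSet.univ]
    simp
  have hvsm : StronglyMeasurable v := by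
    have : v = fun s => ∑ i, if s < t i then a i else 0 := funext hv
    rw [this]
    refine Finset.stronglyMeasurable_fun_sum _ fun i _ => ?_
    exact StronglyMeasurable.ite measurableSet_Iio stronglyMeasurable_const
      stronglyMeasurable_const
  have hvb : ∀ s, ‖v s‖ ≤ ∑ i, ‖a i‖ := by
    intro s
    rw [hv]
    refine (norm_sum_le _ _).trans (Finset.sum_le_sum fun i _ => ?_)
    split_ifs <;> simp
  have hmain : ‖∑ i, Q (t i) (a i)‖ ≤ ‖v 0‖ + ∫ s, ‖v s‖ ∂μ := by
    rw [aux_sum_eq T B hB Q hQ0 hQ N t ht0 htT a v hv]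
    refine (norm_sub_le _ _).trans (add_le_add le_rfl ?_)
    rw [hμ', integral_withDensity_eq_integral_toReal_smul (by fun_prop) (by simp)]
    refine norm_integral_le_of_norm_le ?_ ?_
    · simp only [smul_eq_mul]
      have : Integrable (fun s => w s * ‖v s‖) (volume.restrict (Set.Icc 0 T)) :=
        hwi.mul_bdd (c := ∑ i, ‖a i‖) hvsm.norm.aestronglyMeasurable
          (Filter.Eventually.of_forall fun s => by simpa using hvb s)
      refine this.congr (Filter.Eventually.of_forall fun s => ?_)
      simp [ENNReal.toReal_ofReal (hwn s)]
    · filter_upwards [ae_restrict_mem measurableSet_Icc] with s hs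
      rw [ENNReal.toReal_ofReal (hwn s), smul_eq_mul]
      have hQs := aux_norm_Q_le T B κ' hc (fun s hs => (heq s hs).symm ▸ hBκ s hs) Q hQ0 hQ s hs
      have hBs : ‖B s‖ ≤ κ' s := (heq s hs).symm ▸ hBκ s hs
      calc ‖Q s (B s (v s))‖ ≤ ‖Q s‖ * (‖B s‖ * ‖v s‖) :=
            (Q s).le_opNorm_of_le ((B s).le_opNorm _)
        _ ≤ Real.exp (∫ u in (0:ℝ)..s, κ' u) * (κ' s * ‖v s‖) := by gcongr
        _ = _ := by simp only [hw]; ring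
  rw [hmass]
  exact (Real.rpow_le_rpow (norm_nonneg _) hmain (by linarith)).trans
    (aux_jensen μ (fun s => ‖v s‖) hvsm.norm.measurable (fun s => norm_nonneg _) _ hvb q hq)
end

section
/- Let E be a real Banach space, 0 ≤ t₀ ≤ T, let B : [t₀,T] → L(E,E) be continuous, and let κ : [t₀,T] → ℝ be continuous and nonnegative with ‖B(s)‖ ≤ κ(s) for all s ∈ [t₀,T]. Let Q : [t₀,T] → L(E,E) solve the resolvent equation started at t₀, i.e. Q(t₀) = Id and Q′(t) = −Q(t)∘B(t), let w : [t₀,T] → E be continuous, and let μ_κ be the measure on [t₀,T] with Lebesgue density s ↦ κ(s)·exp(∫_{t₀}^s κ(u) du). Then for every real q ≥ 1: ‖ w(t₀) − ∫_{t₀}^T Q(s)( B(s)( w(s) ) ) ds ‖^q ≤ ( 1 + μ_κ([t₀,T]) )^{q−1} · ( ‖w(t₀)‖^q + ∫_{t₀}^T ‖w(s)‖^q μ_κ(ds) ). -/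
open MeasureTheory

lemma resolvent_norm_le_aux
    {E : Type*} [NormedAddCommGroup E] [NormedSpace ℝ E]
    (t₀ T : ℝ)
    (B : ℝ → E →L[ℝ] E)
    (κ : ℝ → ℝ) (hκ : Continuous κ)
    (hBκ : ∀ s ∈ Set.Icc t₀ T, ‖B s‖ ≤ κ s)
    (Q : ℝ → E →L[ℝ] E) (hQ0 : Q t₀ = 1)
    (hQ : ∀ t ∈ Set.Icc t₀ T,
      HasDerivWithinAt Q (-((Q t).comp (B t))) (Set.Icc t₀ T) t)
    (t : ℝ) (ht : t ∈ Set.Icc t₀ T) :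
    ‖Q t‖ ≤ Real.exp (∫ u in t₀..t, κ u) := by
  have key : ∀ ε : ℝ, 0 < ε → ‖Q t‖ ≤ Real.exp ((∫ u in t₀..t, κ u) + ε * (t - t₀)) := by
    intro ε hε
    have hd : ∀ x : ℝ, HasDerivAt (fun x => Real.exp ((∫ u in t₀..x, κ u) + ε * (x - t₀)))
        (Real.exp ((∫ u in t₀..x, κ u) + ε * (x - t₀)) * (κ x + ε)) x := by
      intro x
      have h1 : HasDerivAt (fun x => ∫ u in t₀..x, κ u) (κ x) x :=
        (hκ.integral_hasStrictDerivAt t₀ x).hasDerivAt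
      have h2 : HasDerivAt (fun x => ε * (x - t₀)) ε x := by
        simpa using ((hasDerivAt_id x).sub_const t₀).const_mul ε
      exact (h1.add h2).exp
    refine image_norm_le_of_norm_deriv_right_lt_deriv_boundary' (f := Q)
      (f' := fun t => -((Q t).comp (B t))) (a := t₀) (b := T)
      (B := fun x => Real.exp ((∫ u in t₀..x, κ u) + ε * (x - t₀)))
      (B' := fun x => Real.exp ((∫ u in t₀..x, κ u) + ε * (x - t₀)) * (κ x + ε))
      (fun x hx => (hQ x hx).continuousWithinAt) ?_ ?_ ?_
      (fun x _ => (hd x).hasDerivWithinAt) ?_ ht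
    · intro x hx
      exact (hQ x ⟨hx.1, hx.2.le⟩).mono_of_mem_nhdsWithin
        (Filter.mem_of_superset (Icc_mem_nhdsGE hx.2) (Set.Icc_subset_Icc_left hx.1))
    · simp only [hQ0, intervalIntegral.integral_same, sub_self, mul_zero, add_zero, Real.exp_zero]
      exact ContinuousLinearMap.norm_id_le
    · exact fun x _ => (hd x).continuousAt.continuousWithinAt
    · intro x hx hxe
      rw [norm_neg]
      have h1 := (Q x).opNorm_comp_le (B x)
      have h2 := hBκ x ⟨hx.1, hx.2.le⟩
      have h3 := Real.exp_pos ((∫ u in t₀..x, κ u) + ε * (x - t₀))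
      rw [hxe] at h1
      have h4 := mul_le_mul_of_nonneg_left h2 h3.le
      have h5 := mul_pos h3 hε
      calc _ ≤ _ := h1
        _ ≤ _ := h4
        _ < _ := by rw [mul_add]; linarith
  have hlim : Filter.Tendsto (fun ε : ℝ => Real.exp ((∫ u in t₀..t, κ u) + ε * (t - t₀)))
      (nhdsWithin 0 (Set.Ioi 0)) (nhds (Real.exp ((∫ u in t₀..t, κ u) + 0 * (t - t₀)))) :=
    Filter.Tendsto.mono_left (Continuous.tendsto (by fun_prop) 0) nhdsWithin_le_nhds
  have := ge_of_tendsto hlim (b := ‖Q t‖)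
    (Filter.eventually_of_mem self_mem_nhdsWithin fun ε hε => key ε hε)
  simpa using this

lemma jensen_dirac_aux (μ : Measure ℝ) [IsFiniteMeasure μ] (t₀ : ℝ) (v : ℝ → ℝ)
    (hv : ∀ x, 0 ≤ v x) (q : ℝ) (hq : 1 ≤ q) (hi : Integrable v μ)
    (hiq : Integrable (fun x => v x ^ q) μ) :
    (v t₀ + ∫ x, v x ∂μ) ^ q ≤
      (1 + (μ Set.univ).toReal) ^ (q - 1) * (v t₀ ^ q + ∫ x, v x ^ q ∂μ) := by
  have d1 : Integrable v (Measure.dirac t₀) := integrable_dirac (by simp)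
  have d2 : Integrable (fun x => v x ^ q) (Measure.dirac t₀) := integrable_dirac (by simp)
  haveI : NeZero (Measure.dirac t₀ + μ) := ⟨by
    intro h
    have := congrArg (fun m => m Set.univ) h
    simp at this⟩
  have J := (convexOn_rpow hq).map_average_le (μ := Measure.dirac t₀ + μ) (f := v)
    (Real.continuous_rpow_const (by linarith)).continuousOn isClosed_Ici
    (Filter.Eventually.of_forall hv) (d1.add_measure hi) (d2.add_measure hiq)
  have hm : (Measure.dirac t₀ + μ).real Set.univ = 1 + (μ Set.univ).toReal := by
    rw [measureReal_add_apply]; simp [Measure.real]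
  rw [average_eq, average_eq, hm, integral_add_measure d1 hi,
    integral_add_measure d2 hiq, integral_dirac, integral_dirac] at J
  set M := 1 + (μ Set.univ).toReal with hM
  have hMp : 0 < M := by positivity
  have hA : 0 ≤ v t₀ + ∫ x, v x ∂μ := add_nonneg (hv _) (integral_nonneg hv)
  simp only [smul_eq_mul] at J
  rw [Real.mul_rpow (by positivity) hA, Real.inv_rpow hMp.le] at J
  rw [Real.rpow_sub hMp, Real.rpow_one]
  have hMq : 0 < M ^ q := by positivity
  rw [inv_mul_le_iff₀ hMq] at J
  calc _ ≤ _ := J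
    _ = _ := by ring

/-- Deterministic form of estimate (2.31): if `Q` solves the resolvent equation on `[t₀,T]`
started at `t₀` with `‖B(s)‖ ≤ κ(s)`, `κ` continuous nonnegative, `w` continuous, and `μ_κ`
is the measure on `[t₀,T]` with density `s ↦ κ(s) e^{∫_{t₀}^s κ}`, then for every `q ≥ 1`:
`‖w(t₀) − ∫_{t₀}^T Q(s)(B(s)(w(s))) ds‖^q
  ≤ (1 + μ_κ([t₀,T]))^{q−1}(‖w(t₀)‖^q + ∫_{t₀}^T ‖w(s)‖^q μ_κ(ds))`. -/
theorem resolvent_damped_rpow_le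
    {E : Type*} [NormedAddCommGroup E] [NormedSpace ℝ E] [CompleteSpace E]
    (t₀ T : ℝ) (ht₀ : 0 ≤ t₀) (ht₀T : t₀ ≤ T)
    (B : ℝ → E →L[ℝ] E) (hB : ContinuousOn B (Set.Icc t₀ T))
    (κ : ℝ → ℝ) (hκ : ContinuousOn κ (Set.Icc t₀ T))
    (hκ0 : ∀ s ∈ Set.Icc t₀ T, 0 ≤ κ s)
    (hBκ : ∀ s ∈ Set.Icc t₀ T, ‖B s‖ ≤ κ s)
    (Q : ℝ → E →L[ℝ] E) (hQ0 : Q t₀ = 1)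
    (hQ : ∀ t ∈ Set.Icc t₀ T,
      HasDerivWithinAt Q (-((Q t).comp (B t))) (Set.Icc t₀ T) t)
    (w : ℝ → E) (hw : ContinuousOn w (Set.Icc t₀ T))
    (μ : Measure ℝ)
    (hμ : μ = (volume.restrict (Set.Icc t₀ T)).withDensity
      (fun s => ENNReal.ofReal (κ s * Real.exp (∫ u in t₀..s, κ u))))
    (q : ℝ) (hq : 1 ≤ q) :
    ‖w t₀ - ∫ s in t₀..T, Q s (B s (w s))‖ ^ q ≤
      (1 + (μ (Set.Icc t₀ T)).toReal) ^ (q - 1) *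
        (‖w t₀‖ ^ q + ∫ s, ‖w s‖ ^ q ∂μ) := by
  have hsub : ∀ s ∈ Set.Icc t₀ T, ∀ u ∈ Set.uIcc t₀ s, u ∈ Set.Icc t₀ T := by
    intro s hs u hu
    rw [Set.uIcc_of_le hs.1] at hu
    exact ⟨hu.1, hu.2.trans hs.2⟩
  obtain ⟨k, hk, hkκ⟩ : ∃ k : ℝ → ℝ, Continuous k ∧ ∀ s ∈ Set.Icc t₀ T, k s = κ s :=
    ⟨Set.IccExtend ht₀T ((Set.Icc t₀ T).restrict κ),
      (continuousOn_iff_continuous_restrict.1 hκ).Icc_extend',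
      fun s hs => Set.IccExtend_of_mem _ _ hs⟩
  obtain ⟨v, hv, hv0, hvw⟩ : ∃ v : ℝ → ℝ, Continuous v ∧ (∀ s, 0 ≤ v s) ∧
      ∀ s ∈ Set.Icc t₀ T, v s = ‖w s‖ :=
    ⟨Set.IccExtend ht₀T ((Set.Icc t₀ T).restrict fun s => ‖w s‖),
      (continuousOn_iff_continuous_restrict.1 hw.norm).Icc_extend',
      fun s => norm_nonneg _,
      fun s hs => Set.IccExtend_of_mem _ _ hs⟩
  have hint : ∀ s ∈ Set.Icc t₀ T, ∫ u in t₀..s, κ u = ∫ u in t₀..s, k u := fun s hs =>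
    intervalIntegral.integral_congr fun u hu => (hkκ u (hsub s hs u hu)).symm
  have hIc : Continuous fun s => ∫ u in t₀..s, k u :=
    intervalIntegral.continuous_primitive (fun a b => hk.intervalIntegrable a b) t₀
  set ρ : ℝ → ℝ := fun s => k s * Real.exp (∫ u in t₀..s, k u) with hρ
  have hρc : Continuous ρ := hk.mul (Real.continuous_exp.comp hIc)
  have hρ0 : ∀ s ∈ Set.Icc t₀ T, 0 ≤ ρ s := fun s hs =>
    mul_nonneg (by rw [hkκ s hs]; exact hκ0 s hs) (Real.exp_pos _).le
  have hμρ : μ = (volume.restrict (Set.Icc t₀ T)).withDensity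
      (fun s => ENNReal.ofReal (ρ s)) := by
    rw [hμ]
    refine withDensity_congr_ae ?_
    filter_upwards [ae_restrict_mem measurableSet_Icc] with s hs
    rw [hint s hs, ← hkκ s hs]
  have hfin : IsFiniteMeasure μ := by
    rw [hμρ]
    exact isFiniteMeasure_withDensity_ofReal
      (hρc.integrableOn_Icc (a := t₀) (b := T)).2
  have hmem : ∀ᵐ s ∂μ, s ∈ Set.Icc t₀ T := by
    rw [hμρ]
    exact (withDensity_absolutelyContinuous _ _).ae_le (ae_restrict_mem measurableSet_Icc)
  have huniv : μ (Set.Icc t₀ T) = μ Set.univ :=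
    measure_congr (by filter_upwards [hmem] with s hs; exact propext ⟨fun _ => trivial, fun _ => hs⟩)
  have hInt : ∀ g : ℝ → ℝ, Continuous g → Integrable g μ := by
    intro g hg
    obtain ⟨C, hC⟩ := isCompact_Icc.exists_bound_of_continuousOn (hg.continuousOn (s := Set.Icc t₀ T))
    refine Integrable.of_bound hg.aestronglyMeasurable C ?_
    filter_upwards [hmem] with s hs using hC s hs
  have hIv : ∫ s, v s ∂μ = ∫ s in t₀..T, ρ s * v s := by
    rw [hμρ, integral_withDensity_eq_integral_toReal_smul
      (by fun_prop) (Filter.Eventually.of_forall fun _ => ENNReal.ofReal_lt_top),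
      intervalIntegral.integral_of_le ht₀T, ← integral_Icc_eq_integral_Ioc]
    refine setIntegral_congr_fun measurableSet_Icc fun s hs => ?_
    simp [ENNReal.toReal_ofReal (hρ0 s hs)]
  have hq0 : 0 ≤ q := by linarith
  have hJ := jensen_dirac_aux μ t₀ v hv0 q hq (hInt v hv)
    (hInt _ (hv.rpow_const fun _ => Or.inr hq0))
  have hIq : ∫ s, v s ^ q ∂μ = ∫ s, ‖w s‖ ^ q ∂μ := by
    refine integral_congr_ae ?_
    filter_upwards [hmem] with s hs
    rw [hvw s hs]
  rw [hIq, hvw t₀ ⟨le_rfl, ht₀T⟩, ← huniv, hIv] at hJ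
  refine le_trans (Real.rpow_le_rpow (norm_nonneg _) ?_ hq0) hJ
  refine (norm_sub_le _ _).trans (add_le_add le_rfl ?_)
  refine intervalIntegral.norm_integral_le_of_norm_le ht₀T ?_
    ((hρc.mul hv).intervalIntegrable _ _)
  refine Filter.Eventually.of_forall fun s hs' => ?_
  have hs : s ∈ Set.Icc t₀ T := ⟨hs'.1.le, hs'.2⟩
  have hQs := resolvent_norm_le_aux t₀ T B k hk
    (fun s hs => by rw [hkκ s hs]; exact hBκ s hs) Q hQ0 hQ s hs
  have hBs : ‖B s‖ ≤ k s := by rw [hkκ s hs]; exact hBκ s hs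
  calc ‖Q s (B s (w s))‖ ≤ ‖Q s‖ * (‖B s‖ * ‖w s‖) :=
        (Q s).le_opNorm_of_le ((B s).le_opNorm _)
    _ ≤ Real.exp (∫ u in t₀..s, k u) * (k s * ‖w s‖) := by gcongr
    _ = ρ s * v s := by rw [hvw s hs, hρ]; ring
end

section
/- Let E be a real Hilbert space, T > 0, let B : [0,T] → L(E,E) be continuous with each B(t) self-adjoint, and let k : [0,T] → ℝ be continuous with ⟨B(t)v, v⟩ ≥ k(t)·‖v‖² for all t ∈ [0,T] and v ∈ E. If Q : [0,T] → L(E,E) satisfies Q(0) = Id and Q′(t) = −Q(t)∘B(t) for all t, then the operator norm satisfies ‖Q(t)‖ ≤ exp( −∫_0^t k(u) du ) for every t ∈ [0,T]. -/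
open scoped RealInnerProductSpace

/-- If each `B(t)` is self-adjoint on a real Hilbert space with `⟨B(t)v,v⟩ ≥ k(t)‖v‖²`,
and `Q` solves the resolvent equation started at `0`, then `‖Q(t)‖ ≤ exp(−∫_0^t k)`. -/
theorem resolvent_norm_le_exp_of_lower_bound
    {E : Type*} [NormedAddCommGroup E] [InnerProductSpace ℝ E] [CompleteSpace E]
    (T : ℝ) (hT : 0 < T)
    (B : ℝ → E →L[ℝ] E) (hB : ContinuousOn B (Set.Icc 0 T))
    (hBsym : ∀ t ∈ Set.Icc (0:ℝ) T, ∀ v w : E, ⟪B t v, w⟫ = ⟪v, B t w⟫)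
    (k : ℝ → ℝ) (hk : ContinuousOn k (Set.Icc 0 T))
    (hBk : ∀ t ∈ Set.Icc (0:ℝ) T, ∀ v : E, k t * ‖v‖ ^ 2 ≤ ⟪B t v, v⟫)
    (Q : ℝ → E →L[ℝ] E) (hQ0 : Q 0 = 1)
    (hQ : ∀ t ∈ Set.Icc (0:ℝ) T,
      HasDerivWithinAt Q (-((Q t).comp (B t))) (Set.Icc 0 T) t) :
    ∀ t ∈ Set.Icc (0:ℝ) T, ‖Q t‖ ≤ Real.exp (-∫ u in (0:ℝ)..t, k u) := by
  obtain ⟨K, hKc, hKk⟩ : ∃ K : ℝ → ℝ, Continuous K ∧ ∀ t ∈ Set.Icc (0:ℝ) T, K t = k t :=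
    ⟨Set.IccExtend hT.le ((Set.Icc 0 T).restrict k), hk.restrict.Icc_extend',
      fun t ht => by rw [Set.IccExtend_of_mem _ _ ht]; rfl⟩
  intro t ht
  have hint : ∫ u in (0:ℝ)..t, k u = ∫ u in (0:ℝ)..t, K u := by
    apply intervalIntegral.integral_congr
    intro u hu
    rw [Set.uIcc_of_le ht.1] at hu
    exact (hKk u ⟨hu.1, hu.2.trans ht.2⟩).symm
  rw [hint]
  have hI : ∀ s, HasDerivAt (fun s => ∫ u in (0:ℝ)..s, K u) (K s) s := fun s =>
    (hKc.integral_hasStrictDerivAt 0 s).hasDerivAt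
  have hBstar : ∀ s ∈ Set.Icc (0:ℝ) T, star (B s) = B s := by
    intro s hs
    rw [ContinuousLinearMap.star_eq_adjoint]
    exact ((ContinuousLinearMap.eq_adjoint_iff _ _).2 (hBsym s hs)).symm
  have key : ∀ v : E, ‖(star (Q t)) v‖ ≤ Real.exp (-∫ u in (0:ℝ)..t, K u) * ‖v‖ := by
    intro v
    have hy : ∀ s ∈ Set.Icc (0:ℝ) T, HasDerivWithinAt (fun s => (star (Q s)) v)
        (-(B s ((star (Q s)) v))) (Set.Icc 0 T) s := by
      intro s hs
      have h1 := (hQ s hs).star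
      have h2 := h1.clm_apply (hasDerivWithinAt_const s (Set.Icc 0 T) v)
      have h3 : star (-((Q s).comp (B s))) = -((B s).comp (star (Q s))) := by
        change star (-(Q s * B s)) = -(B s * star (Q s))
        rw [star_neg, star_mul, hBstar s hs]
      rw [h3] at h2
      simpa using h2
    have hg : ∀ s ∈ Set.Icc (0:ℝ) T, HasDerivWithinAt
        (fun s => ‖(star (Q s)) v‖ ^ 2 * Real.exp (2 * ∫ u in (0:ℝ)..s, K u))
        (2 * ⟪(star (Q s)) v, -(B s ((star (Q s)) v))⟫ * Real.exp (2 * ∫ u in (0:ℝ)..s, K u)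
          + ‖(star (Q s)) v‖ ^ 2 * (Real.exp (2 * ∫ u in (0:ℝ)..s, K u) * (2 * K s)))
        (Set.Icc 0 T) s := by
      intro s hs
      exact (hy s hs).norm_sq.mul (((hI s).const_mul 2).exp.hasDerivWithinAt)
    have hanti := antitoneOn_of_hasDerivWithinAt_nonpos (convex_Icc (0:ℝ) T)
      (fun s hs => (hg s hs).continuousWithinAt)
      (fun s hs => (hg s (interior_subset hs)).mono interior_subset)
      (by
        intro s hs
        have hs' := interior_subset hs
        have h1 := hBk s hs' ((star (Q s)) v)
        rw [inner_neg_right, real_inner_comm, hKk s hs']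
        have h2 := Real.exp_pos (2 * ∫ u in (0:ℝ)..s, K u)
        nlinarith [mul_le_mul_of_nonneg_left h1 h2.le])
    have h0 := hanti ⟨le_rfl, hT.le⟩ ht ht.1
    simp only [hQ0, star_one, intervalIntegral.integral_same, mul_zero, Real.exp_zero, mul_one,
      ContinuousLinearMap.one_apply] at h0
    have h4 : (‖(star (Q t)) v‖ * Real.exp (∫ u in (0:ℝ)..t, K u)) ^ 2 ≤ ‖v‖ ^ 2 := by
      rw [mul_pow, ← Real.exp_nat_mul]
      exact_mod_cast h0
    have h5 := abs_le_of_sq_le_sq h4 (norm_nonneg v) |> (le_abs_self _).trans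
    rw [Real.exp_neg, inv_mul_eq_div, le_div_iff₀ (Real.exp_pos _)]
    exact h5
  rw [← norm_star (Q t)]
  exact ContinuousLinearMap.opNorm_le_bound _ (Real.exp_pos _).le key
end
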